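/- arXiv:2605.00523 — 2 statements merged into one kernel-verified Lean document; each statement's English description precedes it below -/
import Mathlib

section
/- Completeness of the axiomatizations: if φ is valid over the class of all epistemic frames then ⊢_{ICK} φ; if φ is valid over the class of reflexive frames then ⊢_{ICKT} φ; if φ is valid over the class of S4 frames then ⊢_{ICKS4} φ; if φ is valid over the class of S5 frames then ⊢_{ICKS5} φ. -/
namespace ICK

/-- Formulae of the language `L_ICK` over a type of agents and natural-number atoms. -/
inductive Formula (Agent : Type) : Type
  | bot : Formula Agent
  | atom : ℕ → Formula Agent
  | and : Formula Agent → Formula Agent → Formula Agent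
  | or : Formula Agent → Formula Agent → Formula Agent
  | imp : Formula Agent → Formula Agent → Formula Agent
  | know : Agent → Formula Agent → Formula Agent
  | ck : Formula Agent → Formula Agent

namespace Formula

variable {Agent : Type}

/-- `¬φ := φ → ⊥`. -/
def neg (φ : Formula Agent) : Formula Agent := φ.imp Formula.bot

/-- `⊤ := ⊥ → ⊥`. -/
def top : Formula Agent := Formula.imp Formula.bot Formula.bot

/-- `φ ↔ ψ := (φ → ψ) ∧ (ψ → φ)`. -/
def biimp (φ ψ : Formula Agent) : Formula Agent := (φ.imp ψ).and (ψ.imp φ)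

end Formula

/-- The formula `E φ = ⋀_{a ∈ A} K_a φ` (everybody knows). -/
noncomputable def Efml {Agent : Type} [Fintype Agent] (φ : Formula Agent) : Formula Agent :=
  (Finset.univ : Finset Agent).toList.foldr (fun a ψ => (Formula.know a φ).and ψ) Formula.top

/-- A birelational epistemic model: a poset `(W, ≤)` with triangle-confluent
modal relations `R a` and a `≤`-monotone valuation. -/
structure Model (Agent W : Type) where
  le : W → W → Prop
  R : Agent → W → W → Prop
  V : W → ℕ → Prop
  le_refl : ∀ w, le w w
  le_trans : ∀ w v u, le w v → le v u → le w u
  le_antisymm : ∀ w v, le w v → le v w → w = v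
  tri : ∀ a w v u, le w v → R a v u → R a w u
  mono : ∀ w v, le w v → ∀ n, V w n → V v n

/-- The union `R = ⋃_a R_a`. -/
def Model.Step {Agent W : Type} (M : Model Agent W) (w v : W) : Prop := ∃ a, M.R a w v

/-- Intuitionistic truth in an epistemic model. -/
def Sat {Agent W : Type} (M : Model Agent W) : Formula Agent → W → Prop
  | .bot, _ => False
  | .atom n, w => M.V w n
  | .and φ ψ, w => Sat M φ w ∧ Sat M ψ w
  | .or φ ψ, w => Sat M φ w ∨ Sat M ψ w
  | .imp φ ψ, w => ∀ v, M.le w v → Sat M φ v → Sat M ψ v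
  | .know a φ, w => ∀ v, M.R a w v → Sat M φ v
  | .ck φ, w => ∀ v, Relation.ReflTransGen M.Step w v → Sat M φ v

def Model.IsRefl {Agent W : Type} (M : Model Agent W) : Prop := ∀ a w, M.R a w w

def Model.IsTrans {Agent W : Type} (M : Model Agent W) : Prop :=
  ∀ a w v u, M.R a w v → M.R a v u → M.R a w u

def Model.IsSymm {Agent W : Type} (M : Model Agent W) : Prop :=
  ∀ a w v, M.R a w v → M.R a v w

def Model.IsS4 {Agent W : Type} (M : Model Agent W) : Prop := M.IsRefl ∧ M.IsTrans

def Model.IsS5 {Agent W : Type} (M : Model Agent W) : Prop := M.IsS4 ∧ M.IsSymm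

/-- Validity over the class of all epistemic frames. -/
def ValidAll (Agent : Type) (φ : Formula Agent) : Prop :=
  ∀ (W : Type) (M : Model Agent W) (w : W), Sat M φ w

/-- Validity over the class of reflexive epistemic frames. -/
def ValidRefl (Agent : Type) (φ : Formula Agent) : Prop :=
  ∀ (W : Type) (M : Model Agent W), M.IsRefl → ∀ w : W, Sat M φ w

/-- Validity over the class of S4 epistemic frames. -/
def ValidS4 (Agent : Type) (φ : Formula Agent) : Prop :=
  ∀ (W : Type) (M : Model Agent W), M.IsS4 → ∀ w : W, Sat M φ w

/-- Validity over the class of S5 epistemic frames. -/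
def ValidS5 (Agent : Type) (φ : Formula Agent) : Prop :=
  ∀ (W : Type) (M : Model Agent W), M.IsS5 → ∀ w : W, Sat M φ w

/-- Purely propositional formulae (for intuitionistic tautologies). -/
inductive PropForm : Type
  | bot : PropForm
  | atom : ℕ → PropForm
  | and : PropForm → PropForm → PropForm
  | or : PropForm → PropForm → PropForm
  | imp : PropForm → PropForm → PropForm

/-- Kripke models for intuitionistic propositional logic. -/
structure IModel (W : Type) where
  le : W → W → Prop
  le_refl : ∀ w, le w w
  le_trans : ∀ w v u, le w v → le v u → le w u
  V : W → ℕ → Prop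
  mono : ∀ w v, le w v → ∀ n, V w n → V v n

def ISat {W : Type} (M : IModel W) : PropForm → W → Prop
  | .bot, _ => False
  | .atom n, w => M.V w n
  | .and p q, w => ISat M p w ∧ ISat M q w
  | .or p q, w => ISat M p w ∨ ISat M q w
  | .imp p q, w => ∀ v, M.le w v → ISat M p v → ISat M q v

/-- IPC validity of a propositional formula. -/
def IPCValid (p : PropForm) : Prop := ∀ (W : Type) (M : IModel W) (w : W), ISat M p w

/-- Substitution of `L_ICK`-formulae for atoms in a propositional formula. -/
def PropForm.subst {Agent : Type} (σ : ℕ → Formula Agent) : PropForm → Formula Agent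
  | .bot => Formula.bot
  | .atom n => σ n
  | .and p q => (p.subst σ).and (q.subst σ)
  | .or p q => (p.subst σ).or (q.subst σ)
  | .imp p q => (p.subst σ).imp (q.subst σ)

/-- The four Hilbert systems. -/
inductive Sys : Type
  | ick : Sys
  | ickt : Sys
  | icks4 : Sys
  | icks5 : Sys

/-- Systems containing the factivity axiom `T`. -/
def Sys.hasT : Sys → Prop
  | Sys.ick => False
  | _ => True

/-- Systems containing the positive introspection axiom `S4`. -/
def Sys.hasS4 : Sys → Prop
  | Sys.icks4 => True
  | Sys.icks5 => True
  | _ => False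

/-- Systems containing the classicality and negative introspection axioms. -/
def Sys.hasS5 : Sys → Prop
  | Sys.icks5 => True
  | _ => False

/-- Axioms of the Hilbert systems. -/
inductive Ax (Agent : Type) [Fintype Agent] : Sys → Formula Agent → Prop
  | taut (P : Sys) (p : PropForm) (σ : ℕ → Formula Agent) :
      IPCValid p → Ax Agent P (p.subst σ)
  | axK (P : Sys) (a : Agent) (φ ψ : Formula Agent) :
      Ax Agent P ((Formula.know a (φ.imp ψ)).imp ((Formula.know a φ).imp (Formula.know a ψ)))
  | fix (P : Sys) (φ : Formula Agent) :
      Ax Agent P ((Formula.ck φ).biimp (φ.and (Efml (Formula.ck φ))))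
  | axT (P : Sys) (a : Agent) (φ : Formula Agent) :
      P.hasT → Ax Agent P ((Formula.know a φ).imp φ)
  | axS4 (P : Sys) (a : Agent) (φ : Formula Agent) :
      P.hasS4 → Ax Agent P ((Formula.know a φ).imp (Formula.know a (Formula.know a φ)))
  | axKc (P : Sys) (a : Agent) (φ ψ : Formula Agent) :
      P.hasS5 → Ax Agent P (((Formula.know a φ).imp ψ).imp (((Formula.know a φ).neg).or ψ))
  | axS5 (P : Sys) (a : Agent) (φ : Formula Agent) :
      P.hasS5 → Ax Agent P (((Formula.know a φ).neg).imp (Formula.know a ((Formula.know a φ).neg)))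

/-- Theoremhood (derivability without assumptions) in system `P`. -/
inductive Thm (Agent : Type) [Fintype Agent] (P : Sys) : Formula Agent → Prop
  | ax {φ : Formula Agent} : Ax Agent P φ → Thm Agent P φ
  | mp {φ ψ : Formula Agent} : Thm Agent P (φ.imp ψ) → Thm Agent P φ → Thm Agent P ψ
  | nec {φ : Formula Agent} (a : Agent) : Thm Agent P φ → Thm Agent P (Formula.know a φ)
  | mon {φ ψ : Formula Agent} :
      Thm Agent P (φ.imp ψ) → Thm Agent P ((Formula.ck φ).imp (Formula.ck ψ))
  | ind {φ : Formula Agent} :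
      Thm Agent P (φ.imp (Efml φ)) → Thm Agent P (φ.imp (Formula.ck φ))

/-- Derivability of `φ` from assumptions `Γ` in system `P`: the rules of
necessitation, monotonicity and induction may only be applied in
assumption-free subderivations. -/
inductive Deriv (Agent : Type) [Fintype Agent] (P : Sys) (Γ : Set (Formula Agent)) :
    Formula Agent → Prop
  | assum {φ : Formula Agent} : φ ∈ Γ → Deriv Agent P Γ φ
  | thm {φ : Formula Agent} : Thm Agent P φ → Deriv Agent P Γ φ
  | mp {φ ψ : Formula Agent} :
      Deriv Agent P Γ (φ.imp ψ) → Deriv Agent P Γ φ → Deriv Agent P Γ ψ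

section Derivability

variable {Agent : Type} [Fintype Agent] {P : Sys} {Γ Δ : Set (Formula Agent)}
  {φ ψ χ : Formula Agent}

/-- The substitution sending the first three atoms to given formulae. -/
def subst₃ (φ ψ χ : Formula Agent) : ℕ → Formula Agent
  | 0 => φ
  | 1 => ψ
  | _ => χ

namespace Thm

theorem imp_const (φ ψ : Formula Agent) : Thm Agent P (φ.imp (ψ.imp φ)) :=
  .ax (.taut P (.imp (.atom 0) (.imp (.atom 1) (.atom 0))) (subst₃ φ ψ ψ)
    fun _ M _ _ _ h _ hle _ => M.mono _ _ hle _ h)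

theorem imp_distrib (φ ψ χ : Formula Agent) :
    Thm Agent P ((φ.imp (ψ.imp χ)).imp ((φ.imp ψ).imp (φ.imp χ))) :=
  .ax (.taut P
    (.imp (.imp (.atom 0) (.imp (.atom 1) (.atom 2)))
      (.imp (.imp (.atom 0) (.atom 1)) (.imp (.atom 0) (.atom 2)))) (subst₃ φ ψ χ)
    fun _ M _ _ _ h _ hle g u hu hφ =>
      h u (M.le_trans _ _ _ hle hu) hφ u (M.le_refl u) (g u hu hφ))

theorem and_intro (φ ψ : Formula Agent) : Thm Agent P (φ.imp (ψ.imp (φ.and ψ))) :=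
  .ax (.taut P (.imp (.atom 0) (.imp (.atom 1) (.and (.atom 0) (.atom 1)))) (subst₃ φ ψ ψ)
    fun _ M _ _ _ h _ hle g => ⟨M.mono _ _ hle _ h, g⟩)

theorem and_left (φ ψ : Formula Agent) : Thm Agent P ((φ.and ψ).imp φ) :=
  .ax (.taut P (.imp (.and (.atom 0) (.atom 1)) (.atom 0)) (subst₃ φ ψ ψ)
    fun _ _ _ _ _ h => h.1)

theorem and_right (φ ψ : Formula Agent) : Thm Agent P ((φ.and ψ).imp ψ) :=
  .ax (.taut P (.imp (.and (.atom 0) (.atom 1)) (.atom 1)) (subst₃ φ ψ ψ)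
    fun _ _ _ _ _ h => h.2)

theorem or_inl (φ ψ : Formula Agent) : Thm Agent P (φ.imp (φ.or ψ)) :=
  .ax (.taut P (.imp (.atom 0) (.or (.atom 0) (.atom 1))) (subst₃ φ ψ ψ)
    fun _ _ _ _ _ h => Or.inl h)

theorem or_inr (φ ψ : Formula Agent) : Thm Agent P (ψ.imp (φ.or ψ)) :=
  .ax (.taut P (.imp (.atom 1) (.or (.atom 0) (.atom 1))) (subst₃ φ ψ ψ)
    fun _ _ _ _ _ h => Or.inr h)

theorem or_elim (φ ψ χ : Formula Agent) :
    Thm Agent P ((φ.imp χ).imp ((ψ.imp χ).imp ((φ.or ψ).imp χ))) :=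
  .ax (.taut P
    (.imp (.imp (.atom 0) (.atom 2))
      (.imp (.imp (.atom 1) (.atom 2)) (.imp (.or (.atom 0) (.atom 1)) (.atom 2))))
    (subst₃ φ ψ χ)
    fun _ M _ _ _ h _ hle g u hu hor =>
      hor.elim (h u (M.le_trans _ _ _ hle hu)) (g u hu))

theorem bot_elim (φ : Formula Agent) : Thm Agent P (Formula.bot.imp φ) :=
  .ax (.taut P (.imp .bot (.atom 0)) (subst₃ φ φ φ) fun _ _ _ _ _ h => h.elim)

theorem imp_self (φ : Formula Agent) : Thm Agent P (φ.imp φ) :=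
  .mp (.mp (imp_distrib φ (φ.imp φ) φ) (imp_const _ _)) (imp_const _ _)

end Thm

namespace Deriv

theorem mono (h : Deriv Agent P Γ φ) (hsub : Γ ⊆ Δ) : Deriv Agent P Δ φ := by
  induction h with
  | assum h => exact .assum (hsub h)
  | thm h => exact .thm h
  | mp _ _ ih₁ ih₂ => exact .mp ih₁ ih₂

theorem toThm (h : Deriv Agent P ∅ φ) : Thm Agent P φ := by
  induction h with
  | assum h => exact h.elim
  | thm h => exact h
  | mp _ _ ih₁ ih₂ => exact .mp ih₁ ih₂

theorem imp_intro (h : Deriv Agent P (insert φ Γ) ψ) : Deriv Agent P Γ (φ.imp ψ) := by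
  induction h with
  | assum h =>
    rcases h with rfl | h
    · exact .thm (Thm.imp_self _)
    · exact .mp (.thm (Thm.imp_const _ _)) (.assum h)
  | thm h => exact .thm (.mp (Thm.imp_const _ _) h)
  | mp _ _ ih₁ ih₂ => exact .mp (.mp (.thm (Thm.imp_distrib _ _ _)) ih₁) ih₂

theorem and_intro (h₁ : Deriv Agent P Γ φ) (h₂ : Deriv Agent P Γ ψ) :
    Deriv Agent P Γ (φ.and ψ) :=
  .mp (.mp (.thm (Thm.and_intro φ ψ)) h₁) h₂

theorem and_left (h : Deriv Agent P Γ (φ.and ψ)) : Deriv Agent P Γ φ :=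
  .mp (.thm (Thm.and_left φ ψ)) h

theorem and_right (h : Deriv Agent P Γ (φ.and ψ)) : Deriv Agent P Γ ψ :=
  .mp (.thm (Thm.and_right φ ψ)) h

theorem or_elim (h₁ : Deriv Agent P Γ (φ.imp χ)) (h₂ : Deriv Agent P Γ (ψ.imp χ)) :
    Deriv Agent P Γ ((φ.or ψ).imp χ) :=
  .mp (.mp (.thm (Thm.or_elim φ ψ χ)) h₁) h₂

theorem foldr_know_iff (l : List Agent) :
    Deriv Agent P Γ (l.foldr (fun a ψ => (Formula.know a φ).and ψ) Formula.top) ↔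
      ∀ a ∈ l, Deriv Agent P Γ (Formula.know a φ) := by
  induction l with
  | nil => simpa using .thm (Thm.imp_self _)
  | cons a l ih =>
    rw [List.forall_mem_cons, ← ih]
    exact ⟨fun h => ⟨h.and_left, h.and_right⟩, fun h => and_intro h.1 h.2⟩

theorem efml_iff :
    Deriv Agent P Γ (Efml φ) ↔ ∀ a, Deriv Agent P Γ (Formula.know a φ) := by
  simp [Efml, foldr_know_iff]

/-- Derivability is closed under boxing the assumptions. -/
theorem know_of_assumptions {a : Agent}
    (h : Deriv Agent P {χ | Deriv Agent P Γ (Formula.know a χ)} φ) :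
    Deriv Agent P Γ (Formula.know a φ) := by
  induction h with
  | assum h => exact h
  | thm h => exact .thm (.nec a h)
  | mp _ _ ih₁ ih₂ => exact .mp (.mp (.thm (.ax (.axK P a _ _))) ih₁) ih₂

theorem exists_of_sUnion {c : Set (Set (Formula Agent))} (hc : IsChain (· ⊆ ·) c)
    (hne : c.Nonempty) (h : Deriv Agent P (⋃₀ c) φ) : ∃ Γ ∈ c, Deriv Agent P Γ φ := by
  induction h with
  | assum h =>
    obtain ⟨Γ, hΓ, h⟩ := h
    exact ⟨Γ, hΓ, .assum h⟩
  | thm h =>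
    obtain ⟨Γ, hΓ⟩ := hne
    exact ⟨Γ, hΓ, .thm h⟩
  | mp _ _ ih₁ ih₂ =>
    obtain ⟨Γ, hΓ, h₁⟩ := ih₁
    obtain ⟨Δ, hΔ, h₂⟩ := ih₂
    rcases hc.total hΓ hΔ with hle | hle
    · exact ⟨Δ, hΔ, .mp (h₁.mono hle) h₂⟩
    · exact ⟨Γ, hΓ, .mp h₁ (h₂.mono hle)⟩

end Deriv

end Derivability

/-- Consistent, deductively closed sets of formulae with the disjunction property. -/
structure PrimeTheory (Agent : Type) [Fintype Agent] (P : Sys) where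
  carrier : Set (Formula Agent)
  closed : ∀ φ, Deriv Agent P carrier φ → φ ∈ carrier
  bot_notMem : Formula.bot ∉ carrier
  prime : ∀ φ ψ, φ.or ψ ∈ carrier → φ ∈ carrier ∨ ψ ∈ carrier

namespace PrimeTheory

variable {Agent : Type} [Fintype Agent] {P : Sys} {φ ψ : Formula Agent}

theorem mem_mp (w : PrimeTheory Agent P) (h : Thm Agent P (φ.imp ψ)) (hφ : φ ∈ w.carrier) :
    ψ ∈ w.carrier :=
  w.closed _ (.mp (.thm h) (.assum hφ))

theorem mem_of_imp (w : PrimeTheory Agent P) (h : φ.imp ψ ∈ w.carrier) (hφ : φ ∈ w.carrier) :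
    ψ ∈ w.carrier :=
  w.closed _ (.mp (.assum h) (.assum hφ))

theorem notMem_of_neg (w : PrimeTheory Agent P) (h : φ.neg ∈ w.carrier) : φ ∉ w.carrier :=
  fun hφ => w.bot_notMem (w.mem_of_imp h hφ)

theorem know_or_neg (hP : P.hasS5) (w : PrimeTheory Agent P) (a : Agent) (φ : Formula Agent) :
    Formula.know a φ ∈ w.carrier ∨ (Formula.know a φ).neg ∈ w.carrier :=
  (w.prime _ _ (w.closed _ (.thm (.mp (.ax (.axKc P a φ _ hP)) (Thm.imp_self _))))).symm

theorem know_ck (w : PrimeTheory Agent P) (h : Formula.ck φ ∈ w.carrier) (a : Agent) :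
    Formula.know a (Formula.ck φ) ∈ w.carrier :=
  w.closed _ (Deriv.efml_iff.1
    (Deriv.and_right (.mp (Deriv.and_left (.thm (.ax (.fix P φ)))) (.assum h))) a)

theorem of_ck (w : PrimeTheory Agent P) (h : Formula.ck φ ∈ w.carrier) : φ ∈ w.carrier :=
  w.closed _ (Deriv.and_left (.mp (Deriv.and_left (.thm (.ax (.fix P φ)))) (.assum h)))

/-- Lindenbaum's lemma. -/
theorem exists_extension {Γ : Set (Formula Agent)} (h : ¬ Deriv Agent P Γ φ) :
    ∃ w : PrimeTheory Agent P, Γ ⊆ w.carrier ∧ φ ∉ w.carrier := by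
  obtain ⟨T, hΓT, hT⟩ := zorn_subset_nonempty {T | ¬ Deriv Agent P T φ}
    (fun c hcs hc hne => ⟨⋃₀ c,
      fun hd => by
        obtain ⟨T, hTc, hTd⟩ := hd.exists_of_sUnion hc hne
        exact hcs hTc hTd,
      fun _ => Set.subset_sUnion_of_mem⟩) Γ h
  have hnot : ¬ Deriv Agent P T φ := hT.prop
  have imp_of_notMem : ∀ ψ, ψ ∉ T → Deriv Agent P T (ψ.imp φ) := by
    intro ψ hψ
    by_contra hd
    exact hψ (hT.le_of_ge (y := insert ψ T) (fun h => hd h.imp_intro)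
      (Set.subset_insert ψ T) (Set.mem_insert ψ T))
  refine ⟨⟨T, fun ψ hψ => ?_, fun hb => hnot (.mp (.thm (Thm.bot_elim φ)) (.assum hb)),
    fun ψ χ hor => ?_⟩, hΓT, fun hφ => hnot (.assum hφ)⟩
  · by_contra hmem
    exact hnot (.mp (imp_of_notMem ψ hmem) hψ)
  · by_contra! hmem
    exact hnot (.mp (Deriv.or_elim (imp_of_notMem ψ hmem.1) (imp_of_notMem χ hmem.2))
      (.assum hor))

theorem exists_of_know_notMem (u : PrimeTheory Agent P) {a : Agent}
    (h : Formula.know a φ ∉ u.carrier) :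
    ∃ t : PrimeTheory Agent P,
      (∀ χ, Formula.know a χ ∈ u.carrier → χ ∈ t.carrier) ∧ φ ∉ t.carrier := by
  have hnot : ¬ Deriv Agent P {χ | Deriv Agent P u.carrier (Formula.know a χ)} φ :=
    fun hd => h (u.closed _ hd.know_of_assumptions)
  obtain ⟨t, hsub, ht⟩ := exists_extension hnot
  exact ⟨t, fun χ hχ => hsub (.assum hχ), ht⟩

end PrimeTheory

/-- The formulae whose truth values determine that of `φ`; for `C φ` these include all `K_a C φ`. -/
def Formula.ComponentsIn {Agent : Type} (S : Set (Formula Agent)) : Formula Agent → Prop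
  | .bot => True
  | .atom _ => True
  | .and φ ψ => φ ∈ S ∧ ψ ∈ S
  | .or φ ψ => φ ∈ S ∧ ψ ∈ S
  | .imp φ ψ => φ ∈ S ∧ ψ ∈ S
  | .know _ φ => φ ∈ S
  | .ck φ => φ ∈ S ∧ ∀ a, Formula.know a (Formula.ck φ) ∈ S

/-- Sets of formulae closed under components. -/
def ComponentClosed {Agent : Type} (S : Set (Formula Agent)) : Prop :=
  ∀ φ ∈ S, φ.ComponentsIn S

section Closure

variable {Agent : Type} {S T : Set (Formula Agent)} {φ : Formula Agent}

theorem Formula.ComponentsIn.mono (h : φ.ComponentsIn S) (hsub : S ⊆ T) : φ.ComponentsIn T := by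
  cases φ with
  | bot => trivial
  | atom => trivial
  | and => exact ⟨hsub h.1, hsub h.2⟩
  | or => exact ⟨hsub h.1, hsub h.2⟩
  | imp => exact ⟨hsub h.1, hsub h.2⟩
  | know => exact hsub h
  | ck => exact ⟨hsub h.1, fun a => hsub (h.2 a)⟩

theorem ComponentClosed.union (hS : ComponentClosed S) (hT : ComponentClosed T) :
    ComponentClosed (S ∪ T) := by
  rintro φ (h | h)
  · exact (hS φ h).mono Set.subset_union_left
  · exact (hT φ h).mono Set.subset_union_right

theorem ComponentClosed.insert (hS : ComponentClosed S) (hφ : φ.ComponentsIn S) :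
    ComponentClosed (insert φ S) := by
  rintro ψ (rfl | h)
  · exact hφ.mono (Set.subset_insert _ _)
  · exact (hS ψ h).mono (Set.subset_insert _ _)

theorem exists_finite_componentClosed [Finite Agent] (φ : Formula Agent) :
    ∃ S : Set (Formula Agent), S.Finite ∧ ComponentClosed S ∧ φ ∈ S := by
  have binary : ∀ φ ψ χ : Formula Agent,
      (∀ S : Set (Formula Agent), φ ∈ S → ψ ∈ S → χ.ComponentsIn S) →
      (∃ S : Set (Formula Agent), S.Finite ∧ ComponentClosed S ∧ φ ∈ S) →
      (∃ S : Set (Formula Agent), S.Finite ∧ ComponentClosed S ∧ ψ ∈ S) →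
      ∃ S : Set (Formula Agent), S.Finite ∧ ComponentClosed S ∧ χ ∈ S := by
    rintro φ ψ χ hχ ⟨S, hSf, hSc, hφ⟩ ⟨T, hTf, hTc, hψ⟩
    exact ⟨insert χ (S ∪ T), (hSf.union hTf).insert χ,
      (hSc.union hTc).insert (hχ _ (Or.inl hφ) (Or.inr hψ)), Set.mem_insert _ _⟩
  induction φ with
  | bot =>
    exact ⟨{Formula.bot}, Set.finite_singleton _, by rintro _ rfl; trivial, rfl⟩
  | atom n =>
    exact ⟨{Formula.atom n}, Set.finite_singleton _, by rintro _ rfl; trivial, rfl⟩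
  | and φ ψ ih₁ ih₂ => exact binary φ ψ _ (fun _ h₁ h₂ => ⟨h₁, h₂⟩) ih₁ ih₂
  | or φ ψ ih₁ ih₂ => exact binary φ ψ _ (fun _ h₁ h₂ => ⟨h₁, h₂⟩) ih₁ ih₂
  | imp φ ψ ih₁ ih₂ => exact binary φ ψ _ (fun _ h₁ h₂ => ⟨h₁, h₂⟩) ih₁ ih₂
  | know a φ ih => exact binary φ φ _ (fun _ h _ => h) ih ih
  | ck φ ih =>
    obtain ⟨S, hSf, hSc, hφ⟩ := ih
    refine ⟨insert φ.ck (Set.range (fun a => Formula.know a φ.ck)) ∪ S,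
      ((Set.finite_range _).insert _).union hSf, ?_, Or.inl (Set.mem_insert _ _)⟩
    rintro ψ ((rfl | ⟨a, rfl⟩) | h)
    · exact ⟨Or.inr hφ, fun a => Or.inl (Or.inr ⟨a, rfl⟩)⟩
    · exact Or.inl (Set.mem_insert _ _)
    · exact (hSc ψ h).mono Set.subset_union_right

end Closure

section CanonicalModel

variable {Agent : Type} [Fintype Agent] {P : Sys} {S : Set (Formula Agent)} {a : Agent}
  {u v w t : PrimeTheory Agent P} {φ : Formula Agent}

/-- The accessibility relation of the canonical model, which only inspects formulae in `S`. -/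
def CanonicalR (S : Set (Formula Agent)) (a : Agent) (w v : PrimeTheory Agent P) : Prop :=
  ∀ φ, Formula.know a φ ∈ S →
    (Formula.know a φ ∈ w.carrier → φ ∈ v.carrier) ∧
    (P.hasS4 → Formula.know a φ ∈ w.carrier → Formula.know a φ ∈ v.carrier) ∧
    (P.hasS5 → Formula.know a φ ∈ v.carrier → Formula.know a φ ∈ w.carrier)

theorem CanonicalR.of_know (h : ∀ χ, Formula.know a χ ∈ w.carrier → χ ∈ v.carrier) :
    CanonicalR S a w v := by
  refine fun φ _ => ⟨h φ, fun hP hφ => h _ (w.mem_mp (.ax (.axS4 P a φ hP)) hφ),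
    fun hP hφ => (w.know_or_neg hP a φ).resolve_right fun hneg => ?_⟩
  exact v.notMem_of_neg (h _ (w.mem_mp (.ax (.axS5 P a φ hP)) hneg)) hφ

theorem CanonicalR.of_agree (hagree : ∀ φ ∈ S ∪ Formula.neg '' S, φ ∈ w.carrier → φ ∈ v.carrier)
    (h : CanonicalR S a v u) : CanonicalR S a w u := by
  refine fun φ hS => ⟨fun hφ => (h φ hS).1 (hagree _ (Or.inl hS) hφ),
    fun hP hφ => (h φ hS).2.1 hP (hagree _ (Or.inl hS) hφ),
    fun hP hφ => (w.know_or_neg hP a φ).resolve_right fun hneg => ?_⟩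
  exact v.notMem_of_neg (hagree _ (Or.inr ⟨_, hS, rfl⟩) hneg) ((h φ hS).2.2 hP hφ)

/-- The canonical model relative to the set `S`. -/
def canonicalModel (P : Sys) (S : Set (Formula Agent)) : Model Agent (PrimeTheory Agent P) where
  le w v := w.carrier ⊆ v.carrier
  R := CanonicalR S
  V w n := Formula.atom n ∈ w.carrier
  le_refl _ := subset_rfl
  le_trans _ _ _ := Set.Subset.trans
  le_antisymm w v h₁ h₂ := by
    cases w
    cases v
    congr
    exact Set.Subset.antisymm h₁ h₂
  tri _ _ _ _ hle := CanonicalR.of_agree fun _ _ hφ => hle hφ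
  mono _ _ hle _ h := hle h

theorem canonicalModel_isRefl (hP : P.hasT) : (canonicalModel P S).IsRefl :=
  fun a w φ _ => ⟨w.mem_mp (.ax (.axT P a φ hP)), fun _ h => h, fun _ h => h⟩

theorem canonicalModel_isTrans (hP : P.hasS4) : (canonicalModel P S).IsTrans :=
  fun _ _ _ _ h₁ h₂ φ hS =>
    ⟨fun h => (h₂ φ hS).1 ((h₁ φ hS).2.1 hP h),
      fun _ h => (h₂ φ hS).2.1 hP ((h₁ φ hS).2.1 hP h),
      fun hP' h => (h₁ φ hS).2.2 hP' ((h₂ φ hS).2.2 hP' h)⟩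

theorem canonicalModel_isSymm (hT : P.hasT) (hP : P.hasS5) : (canonicalModel P S).IsSymm :=
  fun a w _ h φ hS =>
    ⟨fun hφ => w.mem_mp (.ax (.axT P a φ hT)) ((h φ hS).2.2 hP hφ),
      fun _ => (h φ hS).2.2 hP, fun _ => (h φ hS).2.1 (by cases P <;> trivial)⟩

/-- The conjunction of a list of formulae. -/
def bigAnd (l : List (Formula Agent)) : Formula Agent := l.foldr Formula.and Formula.top

/-- The disjunction of a list of formulae. -/
def bigOr (l : List (Formula Agent)) : Formula Agent := l.foldr Formula.or Formula.bot

theorem deriv_bigAnd_iff {Γ : Set (Formula Agent)} {l : List (Formula Agent)} :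
    Deriv Agent P Γ (bigAnd l) ↔ ∀ φ ∈ l, Deriv Agent P Γ φ := by
  induction l with
  | nil => simpa using .thm (Thm.imp_self _)
  | cons φ l ih =>
    rw [List.forall_mem_cons, ← ih]
    exact ⟨fun h => ⟨h.and_left, h.and_right⟩, fun h => Deriv.and_intro h.1 h.2⟩

theorem deriv_bigOr {Γ : Set (Formula Agent)} {l : List (Formula Agent)} (hφ : φ ∈ l)
    (h : Deriv Agent P Γ φ) : Deriv Agent P Γ (bigOr l) := by
  induction l with
  | nil => simp at hφ
  | cons ψ l ih =>
    rcases List.mem_cons.1 hφ with rfl | hφ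
    · exact .mp (.thm (Thm.or_inl _ _)) h
    · exact .mp (.thm (Thm.or_inr _ _)) (ih hφ)

theorem bigOr_imp {l : List (Formula Agent)} (h : ∀ ψ ∈ l, Deriv Agent P ∅ (ψ.imp φ)) :
    Deriv Agent P ∅ ((bigOr l).imp φ) := by
  induction l with
  | nil => exact .thm (Thm.bot_elim φ)
  | cons ψ l ih =>
    rw [List.forall_mem_cons] at h
    exact Deriv.or_elim h.1 (ih h.2)

open Classical in
/-- The conjunction of the members of `l` that belong to `w`. -/
noncomputable def characteristic (l : List (Formula Agent)) (w : PrimeTheory Agent P) :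
    Formula Agent :=
  bigAnd (l.filter (· ∈ w.carrier))

theorem characteristic_mem_iff {l : List (Formula Agent)} :
    characteristic l w ∈ u.carrier ↔ ∀ φ ∈ l, φ ∈ w.carrier → φ ∈ u.carrier := by
  have mem_iff (φ : Formula Agent) : Deriv Agent P u.carrier φ ↔ φ ∈ u.carrier :=
    ⟨u.closed φ, .assum⟩
  rw [← mem_iff, characteristic, deriv_bigAnd_iff]
  simp only [mem_iff, List.mem_filter, decide_eq_true_eq, and_imp]

/-- Up to equality, there are only finitely many characteristic formulae. -/
theorem exists_list_characteristic (l : List (Formula Agent)) (X : Set (PrimeTheory Agent P)) :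
    ∃ L : List (Formula Agent), ∀ φ, φ ∈ L ↔ ∃ w ∈ X, characteristic l w = φ := by
  classical
  have hfin : (characteristic l '' X).Finite := by
    refine (l.sublists.map bigAnd).toFinset.finite_toSet.subset ?_
    rintro _ ⟨w, _, rfl⟩
    simp only [List.coe_toFinset, List.mem_map, List.mem_sublists, Set.mem_ofPred_eq]
    exact ⟨_, List.filter_sublist, rfl⟩
  exact ⟨hfin.toFinset.toList, by simp⟩

theorem imp_of_forall_mem {ψ : Formula Agent}
    (h : ∀ w : PrimeTheory Agent P, φ ∈ w.carrier → ψ ∈ w.carrier) :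
    Deriv Agent P ∅ (φ.imp ψ) := by
  by_contra hd
  obtain ⟨w, hw, hψ⟩ := PrimeTheory.exists_extension (P := P) (Γ := insert φ ∅) (φ := ψ)
    fun h => hd h.imp_intro
  exact hψ (h w (hw (Set.mem_insert _ _)))

/-- If `φ` holds throughout the worlds reachable from `w`, then `C φ` belongs to `w`. -/
theorem ck_mem_of_reachable (hfin : S.Finite) (hφ : φ ∈ S)
    (h : ∀ v, Relation.ReflTransGen (canonicalModel P S).Step w v → φ ∈ v.carrier) :
    Formula.ck φ ∈ w.carrier := by
  obtain ⟨l, hl⟩ : ∃ l : List (Formula Agent), ∀ ψ, ψ ∈ l ↔ ψ ∈ S ∪ Formula.neg '' S :=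
    ⟨(hfin.union (hfin.image Formula.neg)).toFinset.toList, by simp⟩
  obtain ⟨L, hL⟩ := exists_list_characteristic l
    {v | Relation.ReflTransGen (canonicalModel P S).Step w v}
  have self_mem (v : PrimeTheory Agent P)
      (hv : Relation.ReflTransGen (canonicalModel P S).Step w v) : bigOr L ∈ v.carrier :=
    v.closed _ (deriv_bigOr ((hL _).2 ⟨v, hv, rfl⟩)
      (.assum (characteristic_mem_iff.2 fun _ _ h => h)))
  have hE : Thm Agent P ((bigOr L).imp (Efml (bigOr L))) := by
    refine (bigOr_imp fun ψ hψ => ?_).toThm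
    obtain ⟨v, hv, rfl⟩ := (hL ψ).1 hψ
    refine imp_of_forall_mem fun u hu => u.closed _ (Deriv.efml_iff.2 fun a => .assum ?_)
    by_contra hK
    obtain ⟨t, hut, ht⟩ := u.exists_of_know_notMem hK
    refine ht (self_mem t (hv.tail ⟨a, ?_⟩))
    exact CanonicalR.of_agree
      (fun χ hχ => characteristic_mem_iff.1 hu χ ((hl χ).2 hχ)) (CanonicalR.of_know hut)
  have hφ' : Thm Agent P ((bigOr L).imp φ) := by
    refine (bigOr_imp fun ψ hψ => ?_).toThm
    obtain ⟨v, hv, rfl⟩ := (hL ψ).1 hψ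
    exact imp_of_forall_mem fun u hu =>
      characteristic_mem_iff.1 hu φ ((hl φ).2 (Or.inl hφ)) (h v hv)
  exact w.mem_mp (.mon hφ') (w.mem_mp (.ind hE) (self_mem w .refl))

/-- The truth lemma for the canonical model. -/
theorem sat_canonicalModel_iff (hfin : S.Finite) (hS : ComponentClosed S) (φ : Formula Agent)
    (hφ : φ ∈ S) (w : PrimeTheory Agent P) : Sat (canonicalModel P S) φ w ↔ φ ∈ w.carrier := by
  induction φ generalizing w with
  | bot => exact ⟨False.elim, w.bot_notMem⟩
  | atom n => exact Iff.rfl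
  | and φ ψ ih₁ ih₂ =>
    obtain ⟨h₁, h₂⟩ := hS _ hφ
    rw [Sat, ih₁ h₁, ih₂ h₂]
    exact ⟨fun h => w.closed _ (Deriv.and_intro (.assum h.1) (.assum h.2)),
      fun h => ⟨w.mem_mp (Thm.and_left _ _) h, w.mem_mp (Thm.and_right _ _) h⟩⟩
  | or φ ψ ih₁ ih₂ =>
    obtain ⟨h₁, h₂⟩ := hS _ hφ
    rw [Sat, ih₁ h₁, ih₂ h₂]
    exact ⟨fun h => h.elim (w.mem_mp (Thm.or_inl _ _)) (w.mem_mp (Thm.or_inr _ _)),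
      w.prime φ ψ⟩
  | imp φ ψ ih₁ ih₂ =>
    obtain ⟨h₁, h₂⟩ := hS _ hφ
    simp only [Sat, ih₁ h₁, ih₂ h₂]
    refine ⟨fun h => ?_, fun h v hle => v.mem_of_imp (hle h)⟩
    by_contra hmem
    obtain ⟨v, hv, hψ⟩ := PrimeTheory.exists_extension (P := P)
      (Γ := insert φ w.carrier) (φ := ψ) fun hd => hmem (w.closed _ hd.imp_intro)
    exact hψ (h v (fun _ hχ => hv (Or.inr hχ)) (hv (Set.mem_insert _ _)))
  | know a φ ih =>
    simp only [Sat, ih (hS _ hφ)]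
    refine ⟨fun h => ?_, fun h v hR => (hR φ hφ).1 h⟩
    by_contra hmem
    obtain ⟨t, hwt, ht⟩ := w.exists_of_know_notMem hmem
    exact ht (h t (CanonicalR.of_know hwt))
  | ck φ ih =>
    obtain ⟨h₁, h₂⟩ := hS _ hφ
    simp only [Sat, ih h₁]
    refine ⟨ck_mem_of_reachable hfin h₁, fun h v hv => v.of_ck ?_⟩
    induction hv with
    | refl => exact h
    | tail _ hstep ih =>
      obtain ⟨a, hR⟩ := hstep
      exact (hR _ (h₂ a)).1 (PrimeTheory.know_ck _ ih a)

theorem deriv_of_sat_canonicalModel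
    (h : ∀ (S : Set (Formula Agent)) (w : PrimeTheory Agent P), Sat (canonicalModel P S) φ w) :
    Deriv Agent P ∅ φ := by
  by_contra hd
  obtain ⟨w, _, hw⟩ := PrimeTheory.exists_extension hd
  obtain ⟨S, hfin, hS, hφ⟩ := exists_finite_componentClosed φ
  exact hw ((sat_canonicalModel_iff hfin hS φ hφ w).1 (h S w))

end CanonicalModel

/-- Completeness of the four axiomatizations. -/
theorem completeness (Agent : Type) [Fintype Agent] [Nonempty Agent] (φ : Formula Agent) :
    (ValidAll Agent φ → Deriv Agent Sys.ick ∅ φ) ∧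
    (ValidRefl Agent φ → Deriv Agent Sys.ickt ∅ φ) ∧
    (ValidS4 Agent φ → Deriv Agent Sys.icks4 ∅ φ) ∧
    (ValidS5 Agent φ → Deriv Agent Sys.icks5 ∅ φ) := by
  refine ⟨fun h => ?_, fun h => ?_, fun h => ?_, fun h => ?_⟩ <;>
    refine deriv_of_sat_canonicalModel fun S => ?_
  · exact h _ _
  · exact h _ _ (canonicalModel_isRefl trivial)
  · exact h _ _ ⟨canonicalModel_isRefl trivial, canonicalModel_isTrans trivial⟩
  · exact h _ _ ⟨⟨canonicalModel_isRefl trivial, canonicalModel_isTrans trivial⟩,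
      canonicalModel_isSymm trivial trivial⟩

end ICK
end

section
/- Finite model property: for each of the four frame classes (all epistemic frames, reflexive frames, S4 frames, S5 frames), if a formula φ of L_ICK is not valid over that class, then there exists a FINITE model based on a frame of that class and a world of it at which φ fails. -/
namespace ICK

/-- The set of subformulae of a formula. -/
def Formula.subformulas {Agent : Type} : Formula Agent → Set (Formula Agent)
  | .bot => {.bot}
  | .atom n => {.atom n}
  | .and φ ψ => insert (.and φ ψ) (φ.subformulas ∪ ψ.subformulas)
  | .or φ ψ => insert (.or φ ψ) (φ.subformulas ∪ ψ.subformulas)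
  | .imp φ ψ => insert (.imp φ ψ) (φ.subformulas ∪ ψ.subformulas)
  | .know a φ => insert (.know a φ) φ.subformulas
  | .ck φ => insert (.ck φ) φ.subformulas

theorem Formula.subformulas_finite {Agent : Type} (φ : Formula Agent) :
    φ.subformulas.Finite := by
  induction φ with
  | bot | atom => exact Set.finite_singleton _
  | and _ _ h₁ h₂ | or _ _ h₁ h₂ | imp _ _ h₁ h₂ => exact (h₁.union h₂).insert _
  | know _ _ h | ck _ h => exact h.insert _

theorem Formula.self_mem_subformulas {Agent : Type} (φ : Formula Agent) :
    φ ∈ φ.subformulas := by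
  cases φ <;> simp [Formula.subformulas]

/-- Closure of a set of formulae under immediate subformulae. -/
structure SubformulaClosed {Agent : Type} (S : Set (Formula Agent)) : Prop where
  and : ∀ {φ ψ}, Formula.and φ ψ ∈ S → φ ∈ S ∧ ψ ∈ S
  or : ∀ {φ ψ}, Formula.or φ ψ ∈ S → φ ∈ S ∧ ψ ∈ S
  imp : ∀ {φ ψ}, Formula.imp φ ψ ∈ S → φ ∈ S ∧ ψ ∈ S
  know : ∀ {a φ}, Formula.know a φ ∈ S → φ ∈ S
  ck : ∀ {φ}, Formula.ck φ ∈ S → φ ∈ S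

theorem Formula.subformulas_subset {Agent : Type} {φ ψ : Formula Agent}
    (h : ψ ∈ φ.subformulas) : ψ.subformulas ⊆ φ.subformulas := by
  induction φ with
  | bot | atom =>
    rw [Set.mem_singleton_iff.1 h]
  | and _ _ h₁ h₂ | or _ _ h₁ h₂ | imp _ _ h₁ h₂ =>
    rcases h with rfl | h | h
    · exact subset_rfl
    · exact (h₁ h).trans (Set.subset_union_left.trans (Set.subset_insert _ _))
    · exact (h₂ h).trans (Set.subset_union_right.trans (Set.subset_insert _ _))
  | know _ _ h₁ | ck _ h₁ =>
    rcases h with rfl | h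
    · exact subset_rfl
    · exact (h₁ h).trans (Set.subset_insert _ _)

theorem Formula.subformulaClosed_subformulas {Agent : Type} (φ : Formula Agent) :
    SubformulaClosed φ.subformulas where
  and h := ⟨subformulas_subset h (.inr (.inl (self_mem_subformulas _))),
    subformulas_subset h (.inr (.inr (self_mem_subformulas _)))⟩
  or h := ⟨subformulas_subset h (.inr (.inl (self_mem_subformulas _))),
    subformulas_subset h (.inr (.inr (self_mem_subformulas _)))⟩
  imp h := ⟨subformulas_subset h (.inr (.inl (self_mem_subformulas _))),
    subformulas_subset h (.inr (.inr (self_mem_subformulas _)))⟩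
  know h := subformulas_subset h (.inr (self_mem_subformulas _))
  ck h := subformulas_subset h (.inr (self_mem_subformulas _))

section Filtration

variable {Agent W : Type} {M : Model Agent W} {S : Set (Formula Agent)}

/-- Truth is preserved along the intuitionistic order. -/
theorem Sat.mono {φ : Formula Agent} {w v : W} (hwv : M.le w v) (h : Sat M φ w) :
    Sat M φ v := by
  induction φ generalizing w v with
  | bot => exact h
  | atom n => exact M.mono _ _ hwv n h
  | and _ _ h₁ h₂ => exact ⟨h₁ hwv h.1, h₂ hwv h.2⟩
  | or _ _ h₁ h₂ => exact h.imp (h₁ hwv) (h₂ hwv)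
  | imp => exact fun u hvu => h u (M.le_trans _ _ _ hwv hvu)
  | know a => exact fun u hvu => h u (M.tri a _ _ _ hwv hvu)
  | ck φ ih =>
    intro u hvu
    rcases Relation.ReflTransGen.cases_head hvu with rfl | ⟨x, ⟨a, hvx⟩, hxu⟩
    · exact ih hwv (h w .refl)
    · exact h u (.head ⟨a, M.tri a _ _ _ hwv hvx⟩ hxu)

theorem Sat.ck_of_step {φ : Formula Agent} {a : Agent} {w v : W} (hwv : M.R a w v)
    (h : Sat M (.ck φ) w) : Sat M (.ck φ) v :=
  fun u hvu => h u (.head ⟨a, hwv⟩ hvu)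

/-- `N` is a filtration of `M` through `S` along the map `f`. -/
structure IsFiltration {W' : Type} (M : Model Agent W) (S : Set (Formula Agent))
    (N : Model Agent W') (f : W → W') : Prop where
  surjective : Function.Surjective f
  le_map : ∀ {w v}, M.le w v → N.le (f w) (f v)
  sat_of_le : ∀ {w v φ}, N.le (f w) (f v) → φ ∈ S → Sat M φ w → Sat M φ v
  rel_map : ∀ {a w v}, M.R a w v → N.R a (f w) (f v)
  know_of_rel : ∀ {a w v φ}, N.R a (f w) (f v) → Formula.know a φ ∈ S →
    Sat M (.know a φ) w → Sat M φ v
  ck_of_rel : ∀ {a w v φ}, N.R a (f w) (f v) → Formula.ck φ ∈ S →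
    Sat M (.ck φ) w → Sat M (.ck φ) v
  val_iff : ∀ {w n}, Formula.atom n ∈ S → (N.V (f w) n ↔ M.V w n)

theorem IsFiltration.sat_iff {W' : Type} {N : Model Agent W'} {f : W → W'}
    (hf : IsFiltration M S N f) (hS : SubformulaClosed S) {φ : Formula Agent} (hφ : φ ∈ S)
    (w : W) : Sat N φ (f w) ↔ Sat M φ w := by
  induction φ generalizing w with
  | bot => exact Iff.rfl
  | atom n => exact hf.val_iff hφ
  | and _ _ h₁ h₂ => exact and_congr (h₁ (hS.and hφ).1 w) (h₂ (hS.and hφ).2 w)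
  | or _ _ h₁ h₂ => exact or_congr (h₁ (hS.or hφ).1 w) (h₂ (hS.or hφ).2 w)
  | imp φ ψ h₁ h₂ =>
    have hφS := (hS.imp hφ).1
    have hψS := (hS.imp hφ).2
    constructor
    · exact fun h v hwv hv => (h₂ hψS v).1 (h _ (hf.le_map hwv) ((h₁ hφS v).2 hv))
    · intro h u hwu hu
      obtain ⟨v, rfl⟩ := hf.surjective u
      exact (h₂ hψS v).2 (hf.sat_of_le hwu hφ h v (M.le_refl v) ((h₁ hφS v).1 hu))
  | know a φ ih =>
    constructor
    · exact fun h v hwv => (ih (hS.know hφ) v).1 (h _ (hf.rel_map hwv))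
    · intro h u hwu
      obtain ⟨v, rfl⟩ := hf.surjective u
      exact (ih (hS.know hφ) v).2 (hf.know_of_rel hwu hφ h)
  | ck φ ih =>
    constructor
    · intro h v hwv
      exact (ih (hS.ck hφ) v).1
        (h _ (hwv.lift f fun _ _ ⟨a, hxy⟩ => ⟨a, hf.rel_map hxy⟩))
    · intro h u hwu
      obtain ⟨v, rfl, hv⟩ : ∃ v, f v = u ∧ Sat M (.ck φ) v := by
        induction hwu with
        | refl => exact ⟨w, rfl, h⟩
        | @tail _ y _ hxy ih =>
          obtain ⟨v, rfl, hv⟩ := ih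
          obtain ⟨a, hvy⟩ := hxy
          obtain ⟨v', rfl⟩ := hf.surjective y
          exact ⟨v', rfl, hf.ck_of_rel hvy hφ hv⟩
      exact (ih (hS.ck hφ) v).2 (hv v .refl)

/-- The formulae of `S` true at `w`. -/
def theory (M : Model Agent W) (S : Set (Formula Agent)) (w : W) : Set (Formula Agent) :=
  {φ | φ ∈ S ∧ Sat M φ w}

theorem finite_range_theory (hS : S.Finite) : Finite (Set.range (theory M S)) :=
  (hS.finite_subsets.subset (Set.range_subset_iff.2 fun _ _ h => h.1)).to_subtype

/-- The coarsest filtration: worlds are the realised theories, ordered by inclusion. -/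
def coarseFiltration (M : Model Agent W) (S : Set (Formula Agent)) :
    Model Agent (Set.range (theory M S)) where
  le T U := T.1 ⊆ U.1
  R a T U := (∀ φ, .know a φ ∈ T.1 → φ ∈ U.1) ∧ ∀ φ, .ck φ ∈ T.1 → .ck φ ∈ U.1
  V T n := .atom n ∈ T.1
  le_refl _ := subset_rfl
  le_trans _ _ _ := Set.Subset.trans
  le_antisymm _ _ h h' := Subtype.ext (h.antisymm h')
  tri _ _ _ _ h h' := ⟨fun φ hφ => h'.1 φ (h hφ), fun φ hφ => h'.2 φ (h hφ)⟩
  mono _ _ h _ hn := h hn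

theorem isFiltration_coarseFiltration (hS : SubformulaClosed S) :
    IsFiltration M S (coarseFiltration M S) (Set.rangeFactorization (theory M S)) where
  surjective := Set.rangeFactorization_surjective
  le_map h _ hφ := ⟨hφ.1, hφ.2.mono h⟩
  sat_of_le h hφ hw := (h ⟨hφ, hw⟩).2
  rel_map h := ⟨fun _ hφ => ⟨hS.know hφ.1, hφ.2 _ h⟩, fun _ hφ => ⟨hφ.1, hφ.2.ck_of_step h⟩⟩
  know_of_rel h hφ hw := (h.1 _ ⟨hφ, hw⟩).2
  ck_of_rel h hφ hw := (h.2 _ ⟨hφ, hw⟩).2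
  val_iff hn := ⟨fun h => h.2, fun h => ⟨hn, h⟩⟩

theorem isRefl_coarseFiltration (hS : SubformulaClosed S) (hM : M.IsRefl) :
    (coarseFiltration M S).IsRefl := by
  rintro a ⟨_, w, rfl⟩
  exact (isFiltration_coarseFiltration hS).rel_map (hM a w)

/-- The filtration whose modal relations preserve all known formulae, as in the Lemmon
filtration for `S4`. -/
def transFiltration (M : Model Agent W) (S : Set (Formula Agent)) :
    Model Agent (Set.range (theory M S)) where
  le T U := T.1 ⊆ U.1
  R a T U := (∀ φ, .know a φ ∈ T.1 → .know a φ ∈ U.1) ∧ ∀ φ, .ck φ ∈ T.1 → .ck φ ∈ U.1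
  V T n := .atom n ∈ T.1
  le_refl _ := subset_rfl
  le_trans _ _ _ := Set.Subset.trans
  le_antisymm _ _ h h' := Subtype.ext (h.antisymm h')
  tri _ _ _ _ h h' := ⟨fun φ hφ => h'.1 φ (h hφ), fun φ hφ => h'.2 φ (h hφ)⟩
  mono _ _ h _ hn := h hn

theorem isFiltration_transFiltration (hM : M.IsS4) :
    IsFiltration M S (transFiltration M S) (Set.rangeFactorization (theory M S)) where
  surjective := Set.rangeFactorization_surjective
  le_map h _ hφ := ⟨hφ.1, hφ.2.mono h⟩
  sat_of_le h hφ hw := (h ⟨hφ, hw⟩).2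
  rel_map h := ⟨fun _ hφ => ⟨hφ.1, fun u hu => hφ.2 u (hM.2 _ _ _ _ h hu)⟩,
    fun _ hφ => ⟨hφ.1, hφ.2.ck_of_step h⟩⟩
  know_of_rel h hφ hw := (h.1 _ ⟨hφ, hw⟩).2 _ (hM.1 _ _)
  ck_of_rel h hφ hw := (h.2 _ ⟨hφ, hw⟩).2
  val_iff hn := ⟨fun h => h.2, fun h => ⟨hn, h⟩⟩

theorem isS4_transFiltration : (transFiltration M S).IsS4 :=
  ⟨fun _ _ => ⟨fun _ => id, fun _ => id⟩, fun _ _ _ _ h h' =>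
    ⟨fun φ hφ => h'.1 φ (h.1 φ hφ), fun φ hφ => h'.2 φ (h.2 φ hφ)⟩⟩

/-- The filtration for `S5`: worlds related by an agent agree on what that agent knows, and
comparable worlds agree on all epistemic formulae. -/
def equivFiltration (M : Model Agent W) (S : Set (Formula Agent)) :
    Model Agent (Set.range (theory M S)) where
  le T U := T.1 ⊆ U.1 ∧ (∀ a φ, .know a φ ∈ T.1 ↔ .know a φ ∈ U.1) ∧
    ∀ φ, .ck φ ∈ T.1 ↔ .ck φ ∈ U.1
  R a T U := (∀ φ, .know a φ ∈ T.1 ↔ .know a φ ∈ U.1) ∧ ∀ φ, .ck φ ∈ T.1 ↔ .ck φ ∈ U.1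
  V T n := .atom n ∈ T.1
  le_refl _ := ⟨subset_rfl, fun _ _ => Iff.rfl, fun _ => Iff.rfl⟩
  le_trans _ _ _ h h' := ⟨h.1.trans h'.1, fun a φ => (h.2.1 a φ).trans (h'.2.1 a φ),
    fun φ => (h.2.2 φ).trans (h'.2.2 φ)⟩
  le_antisymm _ _ h h' := Subtype.ext (h.1.antisymm h'.1)
  tri a _ _ _ h h' := ⟨fun φ => (h.2.1 a φ).trans (h'.1 φ), fun φ => (h.2.2 φ).trans (h'.2 φ)⟩
  mono _ _ h _ hn := h.1 hn

theorem isS5_equivFiltration : (equivFiltration M S).IsS5 :=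
  ⟨⟨fun _ _ => ⟨fun _ => Iff.rfl, fun _ => Iff.rfl⟩, fun _ _ _ _ h h' =>
    ⟨fun φ => (h.1 φ).trans (h'.1 φ), fun φ => (h.2 φ).trans (h'.2 φ)⟩⟩,
    fun _ _ _ h => ⟨fun φ => (h.1 φ).symm, fun φ => (h.2 φ).symm⟩⟩

theorem isFiltration_equivFiltration [Nonempty Agent] (hM : M.IsS5) :
    IsFiltration M S (equivFiltration M S) (Set.rangeFactorization (theory M S)) := by
  have know_iff {a w v} (h : M.R a w v) (φ) :
      .know a φ ∈ theory M S w ↔ .know a φ ∈ theory M S v :=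
    and_congr_right fun _ => ⟨fun hw u hu => hw u (hM.1.2 _ _ _ _ h hu),
      fun hv u hu => hv u (hM.1.2 _ _ _ _ (hM.2 _ _ _ h) hu)⟩
  have ck_iff {a w v} (h : M.R a w v) (φ) :
      .ck φ ∈ theory M S w ↔ .ck φ ∈ theory M S v :=
    and_congr_right fun _ => ⟨Sat.ck_of_step h, Sat.ck_of_step (hM.2 _ _ _ h)⟩
  have rel_of_le {w v} (a : Agent) (h : M.le w v) : M.R a w v := M.tri a _ _ _ h (hM.1.1 a v)
  exact {
    surjective := Set.rangeFactorization_surjective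
    le_map h := ⟨fun _ hφ => ⟨hφ.1, hφ.2.mono h⟩, fun a => know_iff (rel_of_le a h),
      ck_iff (rel_of_le (Classical.arbitrary Agent) h)⟩
    sat_of_le h hφ hw := (h.1 ⟨hφ, hw⟩).2
    rel_map h := ⟨know_iff h, ck_iff h⟩
    know_of_rel h hφ hw := ((h.1 _).1 ⟨hφ, hw⟩).2 _ (hM.1.1 _ _)
    ck_of_rel h hφ hw := ((h.2 _).1 ⟨hφ, hw⟩).2
    val_iff _ := ⟨fun h => h.2, fun h => ⟨‹_›, h⟩⟩ }

end Filtration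

/-- Finite model property for all four frame classes. -/
theorem finite_model_property (Agent : Type) [Fintype Agent] [Nonempty Agent]
    (φ : Formula Agent) :
    (¬ ValidAll Agent φ →
      ∃ (W : Type) (_ : Finite W) (M : Model Agent W) (w : W), ¬ Sat M φ w) ∧
    (¬ ValidRefl Agent φ →
      ∃ (W : Type) (_ : Finite W) (M : Model Agent W) (w : W), M.IsRefl ∧ ¬ Sat M φ w) ∧
    (¬ ValidS4 Agent φ →
      ∃ (W : Type) (_ : Finite W) (M : Model Agent W) (w : W), M.IsS4 ∧ ¬ Sat M φ w) ∧
    (¬ ValidS5 Agent φ →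
      ∃ (W : Type) (_ : Finite W) (M : Model Agent W) (w : W), M.IsS5 ∧ ¬ Sat M φ w) := by
  have hS := φ.subformulaClosed_subformulas
  have hφ := φ.self_mem_subformulas
  have hfin := φ.subformulas_finite
  refine ⟨fun h => ?_, fun h => ?_, fun h => ?_, fun h => ?_⟩
  · simp only [ValidAll, not_forall] at h
    obtain ⟨W, M, w, hw⟩ := h
    exact ⟨_, finite_range_theory hfin, _, _,
      fun h => hw (((isFiltration_coarseFiltration hS).sat_iff hS hφ w).1 h)⟩
  · simp only [ValidRefl, not_forall] at h
    obtain ⟨W, M, hM, w, hw⟩ := h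
    exact ⟨_, finite_range_theory hfin, _, _, isRefl_coarseFiltration hS hM,
      fun h => hw (((isFiltration_coarseFiltration hS).sat_iff hS hφ w).1 h)⟩
  · simp only [ValidS4, not_forall] at h
    obtain ⟨W, M, hM, w, hw⟩ := h
    exact ⟨_, finite_range_theory hfin, _, _, isS4_transFiltration,
      fun h => hw (((isFiltration_transFiltration hM).sat_iff hS hφ w).1 h)⟩
  · simp only [ValidS5, not_forall] at h
    obtain ⟨W, M, hM, w, hw⟩ := h
    exact ⟨_, finite_range_theory hfin, _, _, isS5_equivFiltration,
      fun h => hw (((isFiltration_equivFiltration hM).sat_iff hS hφ w).1 h)⟩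

end ICK
end
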